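/- If the form h is critical, then there exists a nontrivial positive H-harmonic function on X, and every positive H-superharmonic function on X is in fact H-harmonic on X. -/

import Mathlib

open Filter Topology

variable {X : Type*}

/-- A graph over `X`: symmetric, nonnegative, zero diagonal, locally summable. -/
def IsGraph (b : X → X → ℝ) : Prop :=
  (∀ x y, 0 ≤ b x y) ∧ (∀ x y, b x y = b y x) ∧ (∀ x, b x x = 0) ∧
    ∀ x, Summable fun y => b x y

/-- Connectedness of the graph `b`: any two vertices are joined by a path of
adjacent vertices. -/
def GraphConnected (b : X → X → ℝ) : Prop :=
  ∀ x y : X, ∃ (n : ℕ) (p : ℕ → X), p 0 = x ∧ p n = y ∧ ∀ i < n, 0 < b (p i) (p (i + 1))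

/-- A set `W` is connected in the graph `b` if any two of its points are joined by a
path of adjacent vertices lying in `W`. -/
def ConnectedIn (b : X → X → ℝ) (W : Set X) : Prop :=
  ∀ x ∈ W, ∀ y ∈ W, ∃ (n : ℕ) (p : ℕ → X), p 0 = x ∧ p n = y ∧
    (∀ i ≤ n, p i ∈ W) ∧ ∀ i < n, 0 < b (p i) (p (i + 1))

/-- Local finiteness of the graph `b`. -/
def LocFin (b : X → X → ℝ) : Prop := ∀ x, {y | 0 < b x y}.Finite

/-- Membership in `F(X)`, the functions against which `b` is summable. -/
def MemF (b : X → X → ℝ) (f : X → ℝ) : Prop :=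
  ∀ x, Summable fun y => b x y * |f y|

/-- The formal Schrödinger operator `H = L + q`. -/
noncomputable def Hop (b : X → X → ℝ) (q : X → ℝ) (f : X → ℝ) (x : X) : ℝ :=
  (∑' y, b x y * (f x - f y)) + q x * f x

/-- Membership in `C_c(X)`: finitely supported functions. -/
def FinSupp (φ : X → ℝ) : Prop := (Function.support φ).Finite

/-- The energy form `h` associated with `b` and `q`, evaluated on `C_c(X)`. -/
noncomputable def hform (b : X → X → ℝ) (q : X → ℝ) (φ : X → ℝ) : ℝ :=
  (1 / 2) * (∑' p : X × X, b p.1 p.2 * (φ p.1 - φ p.2) ^ 2) + ∑' x, q x * φ x ^ 2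

/-- The form `h` is subcritical in `X`. -/
def Subcritical (b : X → X → ℝ) (q : X → ℝ) : Prop :=
  ∃ w : X → ℝ, (∀ x, 0 ≤ w x) ∧ w ≠ 0 ∧
    ∀ φ : X → ℝ, FinSupp φ → (∑' x, w x * φ x ^ 2) ≤ hform b q φ

/-- The capacity of the singleton `{x}` with respect to the form `h`. -/
noncomputable def capH (b : X → X → ℝ) (q : X → ℝ) (x : X) : ℝ :=
  sInf {r : ℝ | ∃ φ : X → ℝ, FinSupp φ ∧ φ x = 1 ∧ r = hform b q φ}

/-- The extended (extended-real-valued) energy of the weighted Laplacian part. -/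
noncomputable def hExt (b : X → X → ℝ) (f : X → ℝ) : ENNReal :=
  (∑' p : X × X, ENNReal.ofReal (b p.1 p.2 * (f p.1 - f p.2) ^ 2)) / 2

/-- The diagonal coefficient of the Schrödinger operator: weighted degree plus potential. -/
noncomputable def diagCoeff (b : X → X → ℝ) (q : X → ℝ) (x : X) : ℝ :=
  (∑' y, b x y) + q x

theorem Hop_eq_diagCoeff_sub {b : X → X → ℝ} (hb : IsGraph b) (q : X → ℝ) {u : X → ℝ}
    (hu : ∀ x, Summable fun y => b x y * u y) (x : X) :
    Hop b q u x = diagCoeff b q x * u x - ∑' y, b x y * u y := by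
  have h1 : (∑' y, b x y * (u x - u y)) = (∑' y, b x y) * u x - ∑' y, b x y * u y := by
    rw [← tsum_mul_right, ← ((hb.2.2.2 x).mul_right (u x)).tsum_sub (hu x)]
    exact tsum_congr fun y => by ring
  rw [Hop, h1, diagCoeff]
  ring

/-- The energy form of a finitely supported function, written as a finite quadratic form. -/
theorem hform_eq_sum {b : X → X → ℝ} (hb : IsGraph b) (q : X → ℝ) {φ : X → ℝ} {T : Finset X}
    (hT : ∀ x ∉ T, φ x = 0) :
    hform b q φ = ∑ x ∈ T, diagCoeff b q x * φ x ^ 2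
      - ∑ x ∈ T, ∑ y ∈ T, b x y * (φ x * φ y) := by
  obtain ⟨hnn, hsymm, -, hsum⟩ := hb
  have hs1 : Summable fun p : X × X => b p.1 p.2 * φ p.1 ^ 2 := by
    rw [summable_prod_of_nonneg fun p => mul_nonneg (hnn _ _) (sq_nonneg _)]
    refine ⟨fun x => (hsum x).mul_right (φ x ^ 2), ?_⟩
    refine summable_of_hasFiniteSupport (T.finite_toSet.subset fun x hx => ?_)
    by_contra hxT
    exact hx (by simp [hT x hxT])
  have ht1 : (∑' p : X × X, b p.1 p.2 * φ p.1 ^ 2) = ∑ x ∈ T, (∑' y, b x y) * φ x ^ 2 := by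
    rw [hs1.tsum_prod' fun x => (hsum x).mul_right (φ x ^ 2),
      tsum_eq_sum (s := T) fun x hx => by simp [hT x hx]]
    exact Finset.sum_congr rfl fun x _ => tsum_mul_right (f := b x) (a := φ x ^ 2)
  have hswap : (fun p : X × X => b p.1 p.2 * φ p.2 ^ 2)
      = (fun p : X × X => b p.1 p.2 * φ p.1 ^ 2) ∘ Equiv.prodComm X X := by
    funext p
    simp [hsymm p.1 p.2]
  have hs2 : Summable fun p : X × X => b p.1 p.2 * φ p.2 ^ 2 := by
    rw [hswap]
    exact (Equiv.prodComm X X).summable_iff.mpr hs1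
  have ht2 : (∑' p : X × X, b p.1 p.2 * φ p.2 ^ 2) = ∑' p : X × X, b p.1 p.2 * φ p.1 ^ 2 := by
    rw [hswap]
    exact (Equiv.prodComm X X).tsum_eq fun p : X × X => b p.1 p.2 * φ p.1 ^ 2
  have hz : ∀ p ∉ T ×ˢ T, b p.1 p.2 * (φ p.1 * φ p.2) = 0 := by
    intro p hp
    by_cases h1 : p.1 ∈ T
    · have h2 : p.2 ∉ T := fun h2 => hp (Finset.mem_product.mpr ⟨h1, h2⟩)
      simp [hT _ h2]
    · simp [hT _ h1]
  have hs3 : Summable fun p : X × X => b p.1 p.2 * (φ p.1 * φ p.2) :=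
    summable_of_ne_finset_zero hz
  have ht3 : (∑' p : X × X, b p.1 p.2 * (φ p.1 * φ p.2))
      = ∑ x ∈ T, ∑ y ∈ T, b x y * (φ x * φ y) := by
    rw [tsum_eq_sum hz, Finset.sum_product]
  have hsq : (∑' p : X × X, b p.1 p.2 * (φ p.1 - φ p.2) ^ 2)
      = 2 * ∑ x ∈ T, (∑' y, b x y) * φ x ^ 2
        - 2 * ∑ x ∈ T, ∑ y ∈ T, b x y * (φ x * φ y) := by
    rw [← ht3, ← tsum_mul_left (a := (2 : ℝ)) (f := fun p : X × X => b p.1 p.2 * (φ p.1 * φ p.2)),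
      two_mul, ← ht1]
    nth_rewrite 2 [← ht2]
    rw [← hs1.tsum_add hs2, ← (hs1.add hs2).tsum_sub (hs3.mul_left 2)]
    exact tsum_congr fun p => by ring
  have hq : (∑' x, q x * φ x ^ 2) = ∑ x ∈ T, q x * φ x ^ 2 :=
    tsum_eq_sum fun x hx => by simp [hT x hx]
  have hd : ∑ x ∈ T, diagCoeff b q x * φ x ^ 2
      = ∑ x ∈ T, (∑' y, b x y) * φ x ^ 2 + ∑ x ∈ T, q x * φ x ^ 2 := by
    rw [← Finset.sum_add_distrib]
    exact Finset.sum_congr rfl fun x _ => by rw [diagCoeff]; ring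
  rw [hform, hsq, hq, hd]
  ring

theorem FinSupp.exists_finset {φ : X → ℝ} (h : FinSupp φ) : ∃ T : Finset X, ∀ x ∉ T, φ x = 0 :=
  
  ⟨Set.Finite.toFinset h, fun _ hx =>
    Function.notMem_support.mp fun hm => hx ((Set.Finite.mem_toFinset h).mpr hm)⟩

theorem finSupp_of_finset {φ : X → ℝ} {T : Finset X} (hT : ∀ x ∉ T, φ x = 0) : FinSupp φ :=
  T.finite_toSet.subset fun x hx => by
    by_contra h
    exact hx (hT x h)

theorem hform_abs_le {b : X → X → ℝ} (hb : IsGraph b) (q : X → ℝ) {φ : X → ℝ}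
    (hφ : FinSupp φ) : hform b q (fun x => |φ x|) ≤ hform b q φ := by
  obtain ⟨T, hT⟩ := hφ.exists_finset
  rw [hform_eq_sum hb q hT, hform_eq_sum hb q (φ := fun x => |φ x|) (T := T)
    fun x hx => by simp [hT x hx]]
  simp only [sq_abs]
  refine sub_le_sub_left (Finset.sum_le_sum fun x _ => Finset.sum_le_sum fun y _ => ?_) _
  refine mul_le_mul_of_nonneg_left ?_ (hb.1 x y)
  rw [← abs_mul]
  exact le_abs_self _

theorem hform_const_mul {b : X → X → ℝ} (q : X → ℝ) (c : ℝ) (φ : X → ℝ) :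
    hform b q (fun x => c * φ x) = c ^ 2 * hform b q φ := by
  have h1 : (∑' p : X × X, b p.1 p.2 * (c * φ p.1 - c * φ p.2) ^ 2)
      = c ^ 2 * ∑' p : X × X, b p.1 p.2 * (φ p.1 - φ p.2) ^ 2 := by
    rw [← tsum_mul_left]
    exact tsum_congr fun p => by ring
  have h2 : (∑' x, q x * (c * φ x) ^ 2) = c ^ 2 * ∑' x, q x * φ x ^ 2 := by
    rw [← tsum_mul_left]
    exact tsum_congr fun p => by ring
  rw [hform, h1, h2, hform]
  ring

/-- Cauchy-Schwarz inequality for the energy form against the indicator of a vertex. -/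
theorem abs_diagCoeff_mul_sub_sum_le {b : X → X → ℝ} {q : X → ℝ} (hb : IsGraph b)
    (hpos : ∀ φ : X → ℝ, FinSupp φ → 0 ≤ hform b q φ) {φ : X → ℝ} {T : Finset X}
    (hT : ∀ x ∉ T, φ x = 0) {x : X} (hx : x ∈ T) :
    |diagCoeff b q x * φ x - ∑ y ∈ T, b x y * φ y|
      ≤ Real.sqrt (diagCoeff b q x * hform b q φ) := by
  classical
  have key : ∀ t : ℝ, 0 ≤ diagCoeff b q x * (t * t)
      + (2 * (diagCoeff b q x * φ x - ∑ y ∈ T, b x y * φ y)) * t + hform b q φ := by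
    intro t
    have hT' : ∀ y ∉ T, φ y + (if y = x then t else 0) = 0 := fun y hy => by
      have : y ≠ x := fun h => hy (h ▸ hx)
      simp [hT y hy, this]
    have h0 := hpos _ (finSupp_of_finset hT')
    rw [hform_eq_sum hb q hT'] at h0
    rw [hform_eq_sum hb q hT]
    have e1 : ∑ y ∈ T, diagCoeff b q y * (φ y + (if y = x then t else 0)) ^ 2
        = ∑ y ∈ T, diagCoeff b q y * φ y ^ 2
          + diagCoeff b q x * (2 * φ x * t + t * t) := by
      have : ∀ y ∈ T, diagCoeff b q y * (φ y + (if y = x then t else 0)) ^ 2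
          = diagCoeff b q y * φ y ^ 2
            + (if y = x then diagCoeff b q y * (2 * φ y * t + t * t) else 0) := by
        intro y _
        split_ifs <;> ring
      rw [Finset.sum_congr rfl this, Finset.sum_add_distrib, Finset.sum_ite_eq' T x, if_pos hx]
    have e2 : ∑ y ∈ T, ∑ z ∈ T, b y z
          * ((φ y + (if y = x then t else 0)) * (φ z + (if z = x then t else 0)))
        = ∑ y ∈ T, ∑ z ∈ T, b y z * (φ y * φ z) + 2 * t * ∑ y ∈ T, b x y * φ y := by
      have h1 : ∀ y ∈ T, ∑ z ∈ T, b y z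
            * ((φ y + (if y = x then t else 0)) * (φ z + (if z = x then t else 0)))
          = ∑ z ∈ T, b y z * (φ y * φ z) + t * (b x y * φ y)
            + (if y = x then t * ∑ z ∈ T, b y z * φ z else 0) := by
        intro y _
        have h2 : ∀ z ∈ T, b y z
              * ((φ y + (if y = x then t else 0)) * (φ z + (if z = x then t else 0)))
            = b y z * (φ y * φ z) + (if z = x then t * (b y z * φ y) else 0)
              + (if y = x then t * (b y z * φ z) else 0) := by
          intro z _
          split_ifs with hy hz
          · subst hy hz
            rw [hb.2.2.1]
            ring
          all_goals ring
        rw [Finset.sum_congr rfl h2, Finset.sum_add_distrib, Finset.sum_add_distrib,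
          Finset.sum_ite_eq' T x, if_pos hx, hb.2.1 y x]
        split_ifs
        · rw [Finset.mul_sum]
        · simp
      rw [Finset.sum_congr rfl h1, Finset.sum_add_distrib, Finset.sum_add_distrib,
        Finset.sum_ite_eq' T x, if_pos hx, ← Finset.mul_sum]
      ring
    rw [e1, e2] at h0
    linarith
  have hd := discrim_le_zero key
  rw [discrim] at hd
  apply Real.abs_le_sqrt
  linarith

theorem sum_le_diagCoeff_mul_add_sqrt {b : X → X → ℝ} {q : X → ℝ} (hb : IsGraph b)
    (hpos : ∀ φ : X → ℝ, FinSupp φ → 0 ≤ hform b q φ) {φ : X → ℝ} (hφ : FinSupp φ)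
    (hφ0 : ∀ x, 0 ≤ φ x) (x : X) (S : Finset X) :
    ∑ y ∈ S, b x y * φ y
      ≤ diagCoeff b q x * φ x + Real.sqrt (diagCoeff b q x * hform b q φ) := by
  classical
  obtain ⟨T, hT⟩ := hφ.exists_finset
  have h := (abs_le.mp (abs_diagCoeff_mul_sub_sum_le hb hpos (φ := φ) (T := insert x (S ∪ T))
    (fun y hy => hT y fun h => hy (by simp [h])) (Finset.mem_insert_self x _))).1
  have hle : ∑ y ∈ S, b x y * φ y ≤ ∑ y ∈ insert x (S ∪ T), b x y * φ y :=
    Finset.sum_le_sum_of_subset_of_nonneg (fun y hy => by simp [hy])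
      fun y _ _ => mul_nonneg (hb.1 x y) (hφ0 y)
  linarith

/-- The diagonal coefficients of a nonnegative energy form are nonnegative. -/
theorem diagCoeff_nonneg {b : X → X → ℝ} {q : X → ℝ} (hb : IsGraph b)
    (hpos : ∀ φ : X → ℝ, FinSupp φ → 0 ≤ hform b q φ) (x : X) : 0 ≤ diagCoeff b q x := by
  classical
  have hT : ∀ y ∉ ({x} : Finset X), (if y = x then (1 : ℝ) else 0) = 0 := fun y hy => by
    simpa using hy
  have h := hpos _ (finSupp_of_finset hT)
  rw [hform_eq_sum hb q hT] at h
  simpa [hb.2.2.1] using h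

/-- A property that passes to adjacent vertices of a connected graph and holds at one vertex
holds at every vertex. -/
theorem GraphConnected.induction {b : X → X → ℝ} (hconn : GraphConnected b) {P : X → Prop}
    {o : X} (ho : P o) (hstep : ∀ x y, 0 < b x y → P x → P y) (x : X) : P x := by
  obtain ⟨n, p, hp0, hpn, hp⟩ := hconn o x
  have : ∀ i ≤ n, P (p i) := by
    intro i
    induction i with
    | zero => intro _; rwa [hp0]
    | succ i ih => exact fun hi => hstep _ _ (hp i hi) (ih (by omega))
  exact hpn ▸ this n le_rfl

/-- A nonnegative superharmonic function that is not zero is strictly positive. -/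
theorem pos_of_superharmonic {b : X → X → ℝ} {q : X → ℝ} (hb : IsGraph b)
    (hconn : GraphConnected b) {u : X → ℝ} (hu0 : ∀ x, 0 ≤ u x)
    (hu : ∀ x, Summable fun y => b x y * u y) (hne : u ≠ 0)
    (hsup : ∀ x, 0 ≤ Hop b q u x) (x : X) : 0 < u x := by
  refine (hu0 x).lt_of_ne fun hx => hne (funext fun y => ?_)
  refine hconn.induction (P := fun z => u z = 0) hx.symm (fun y z hyz hy => ?_) y
  have h := hsup y
  rw [Hop_eq_diagCoeff_sub hb q hu, hy] at h
  have hle : b y z * u z ≤ ∑' z, b y z * u z :=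
    (hu y).le_tsum z fun z _ => mul_nonneg (hb.1 y z) (hu0 z)
  have : b y z * u z ≤ 0 := by linarith
  exact le_antisymm (nonpos_of_mul_nonpos_right this hyz) (hu0 z)

/-- A strictly positive function `u` yields the Hardy-type inequality with weight `H u / u`. -/
theorem sum_Hop_div_mul_sq_le_hform {b : X → X → ℝ} {q : X → ℝ} (hb : IsGraph b) {u : X → ℝ}
    (hu0 : ∀ x, 0 < u x) (hu : ∀ x, Summable fun y => b x y * u y) {φ : X → ℝ}
    (hφ : FinSupp φ) : (∑' x, Hop b q u x / u x * φ x ^ 2) ≤ hform b q φ := by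
  obtain ⟨T, hT⟩ := hφ.exists_finset
  rw [hform_eq_sum hb q hT, tsum_eq_sum (s := T) fun x hx => by simp [hT x hx]]
  have h1 : ∀ x ∈ T, Hop b q u x / u x * φ x ^ 2
      ≤ diagCoeff b q x * φ x ^ 2 - ∑ y ∈ T, b x y * (u y / u x * φ x ^ 2) := by
    intro x _
    have hx := (hu0 x).ne'
    have hle : ∑ y ∈ T, b x y * u y ≤ ∑' y, b x y * u y :=
      (hu x).sum_le_tsum T fun y _ => mul_nonneg (hb.1 x y) (hu0 y).le
    have e1 : ∑ y ∈ T, b x y * (u y / u x * φ x ^ 2)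
        = (∑ y ∈ T, b x y * u y) * (φ x ^ 2 / u x) := by
      rw [Finset.sum_mul]
      exact Finset.sum_congr rfl fun y _ => by ring
    have e2 : Hop b q u x / u x * φ x ^ 2
        = diagCoeff b q x * φ x ^ 2 - (∑' y, b x y * u y) * (φ x ^ 2 / u x) := by
      rw [Hop_eq_diagCoeff_sub hb q hu]
      field_simp
    rw [e1, e2]
    exact sub_le_sub_left
      (mul_le_mul_of_nonneg_right hle (div_nonneg (sq_nonneg _) (hu0 x).le)) _
  refine (Finset.sum_le_sum h1).trans ?_
  rw [Finset.sum_sub_distrib]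
  refine sub_le_sub_left ?_ _
  have hswap : ∑ x ∈ T, ∑ y ∈ T, b x y * (u y / u x * φ x ^ 2)
      = ∑ x ∈ T, ∑ y ∈ T, b x y * (u x / u y * φ y ^ 2) := by
    rw [Finset.sum_comm]
    exact Finset.sum_congr rfl fun x _ => Finset.sum_congr rfl fun y _ => by rw [hb.2.1 x y]
  have hpicone : ∑ x ∈ T, ∑ y ∈ T, 2 * (b x y * (φ x * φ y))
      ≤ ∑ x ∈ T, ∑ y ∈ T, (b x y * (u y / u x * φ x ^ 2) + b x y * (u x / u y * φ y ^ 2)) := by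
    refine Finset.sum_le_sum fun x _ => Finset.sum_le_sum fun y _ => ?_
    have hx := hu0 x
    have hy := hu0 y
    have hsq : u y / u x * φ x ^ 2 + u x / u y * φ y ^ 2 - 2 * (φ x * φ y)
        = (u y * φ x - u x * φ y) ^ 2 / (u x * u y) := by
      field_simp
      ring
    have : 0 ≤ (u y * φ x - u x * φ y) ^ 2 / (u x * u y) := by positivity
    nlinarith [hb.1 x y]
  simp only [Finset.sum_add_distrib, ← Finset.mul_sum] at hpicone
  rw [← hswap] at hpicone
  linarith

/-- A critical form admits nonnegative test functions normalized at a vertex of arbitrarily small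
energy. -/
theorem exists_hform_lt_of_not_subcritical {b : X → X → ℝ} {q : X → ℝ} (hb : IsGraph b)
    (hpos : ∀ φ : X → ℝ, FinSupp φ → 0 ≤ hform b q φ) (hcrit : ¬ Subcritical b q) (o : X)
    {ε : ℝ} (hε : 0 < ε) :
    ∃ φ : X → ℝ, FinSupp φ ∧ (∀ x, 0 ≤ φ x) ∧ φ o = 1 ∧ hform b q φ < ε := by
  classical
  by_contra! hno
  refine hcrit ⟨fun x => if x = o then ε else 0, fun x => ?_, fun h => ?_, fun φ hφ => ?_⟩
  · dsimp only
    split_ifs <;> linarith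
  · simpa [hε.ne'] using congrFun h o
  · have ht : (∑' x, (if x = o then ε else 0) * φ x ^ 2) = ε * φ o ^ 2 := by
      rw [tsum_eq_single o fun x hx => by simp [hx]]
      simp
    rw [ht]
    by_cases ho : φ o = 0
    · simpa [ho] using hpos φ hφ
    have hsupp : FinSupp fun x => (φ o)⁻¹ * φ x := by
      obtain ⟨T, hT⟩ := hφ.exists_finset
      exact finSupp_of_finset (T := T) fun x hx => by simp [hT x hx]
    have habs : FinSupp fun x => |(φ o)⁻¹ * φ x| := by
      obtain ⟨T, hT⟩ := hsupp.exists_finset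
      exact finSupp_of_finset (T := T) fun x hx => by rw [hT x hx, abs_zero]
    have h := (hno _ habs (fun x => abs_nonneg _) (by simp [ho])).trans
      (hform_abs_le hb q hsupp)
    rw [hform_const_mul, inv_pow, ← div_eq_inv_mul, le_div_iff₀ (by positivity)] at h
    exact h

/-- A critical form admits a positive superharmonic function. -/
theorem exists_superharmonic_of_not_subcritical [Nonempty X] {b : X → X → ℝ} {q : X → ℝ}
    (hb : IsGraph b) (hconn : GraphConnected b)
    (hpos : ∀ φ : X → ℝ, FinSupp φ → 0 ≤ hform b q φ) (hcrit : ¬ Subcritical b q) :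
    ∃ v : X → ℝ, MemF b v ∧ (∀ x, 0 ≤ v x) ∧ v ≠ 0 ∧ ∀ x, 0 ≤ Hop b q v x := by
  obtain ⟨o⟩ := ‹Nonempty X›
  choose e hes he0 heo heε using fun n : ℕ =>
    exists_hform_lt_of_not_subcritical hb hpos hcrit o (Nat.one_div_pos_of_nat (α := ℝ) (n := n))
  have hsum : ∀ (n : ℕ) (x : X) (S : Finset X), ∑ y ∈ S, b x y * e n y
      ≤ diagCoeff b q x * e n x + Real.sqrt (diagCoeff b q x * (1 / ((n : ℝ) + 1))) :=
    fun n x S => (sum_le_diagCoeff_mul_add_sqrt hb hpos (hes n) (he0 n) x S).trans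
      (add_le_add_right (Real.sqrt_le_sqrt
        (mul_le_mul_of_nonneg_left (heε n).le (diagCoeff_nonneg hb hpos x))) _)
  have hbdd : ∀ x, ∃ C : ℝ, ∀ n, e n x ≤ C := by
    refine hconn.induction (o := o) ⟨1, fun n => (heo n).le⟩ fun x y hxy ⟨C, hC⟩ => ?_
    have hD := diagCoeff_nonneg hb hpos x
    refine ⟨(diagCoeff b q x * C + Real.sqrt (diagCoeff b q x)) / b x y, fun n => ?_⟩
    rw [le_div_iff₀ hxy, mul_comm]
    have h := hsum n x {y}
    rw [Finset.sum_singleton] at h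
    refine h.trans (add_le_add (mul_le_mul_of_nonneg_left (hC n) hD) (Real.sqrt_le_sqrt ?_))
    refine mul_le_of_le_one_right hD ?_
    rw [div_le_one (by positivity)]
    linarith [n.cast_nonneg (α := ℝ)]
  have hlim : ∀ x, ∃ a, Tendsto (fun n => e n x) (hyperfilter ℕ) (𝓝 a) := by
    intro x
    obtain ⟨C, hC⟩ := hbdd x
    obtain ⟨a, -, ha⟩ := (isCompact_Icc (a := (0 : ℝ)) (b := C)).ultrafilter_le_nhds
      ((hyperfilter ℕ).map fun n => e n x)
      (le_principal_iff.mpr (Filter.mem_map.mpr (univ_mem' fun n => ⟨he0 n x, hC n⟩)))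
    exact ⟨a, ha⟩
  choose v hv using hlim
  have hv0 : ∀ x, 0 ≤ v x := fun x => ge_of_tendsto' (hv x) fun n => he0 n x
  have hvo : v o = 1 := tendsto_nhds_unique (hv o) (by simp [heo])
  have hvsum : ∀ (x : X) (S : Finset X), ∑ y ∈ S, b x y * v y ≤ diagCoeff b q x * v x := by
    intro x S
    have h0 : Tendsto (fun n : ℕ => Real.sqrt (diagCoeff b q x * (1 / ((n : ℝ) + 1))))
        (hyperfilter ℕ) (𝓝 0) := by
      have h := ((tendsto_one_div_add_atTop_nhds_zero_nat (𝕜 := ℝ)).const_mul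
        (diagCoeff b q x)).sqrt
      rw [mul_zero, Real.sqrt_zero] at h
      exact h.mono_left Nat.hyperfilter_le_atTop
    have h1 := ((hv x).const_mul (diagCoeff b q x)).add h0
    rw [add_zero] at h1
    exact le_of_tendsto_of_tendsto' (tendsto_finsetSum S fun y _ => (hv y).const_mul (b x y)) h1
      fun n => hsum n x S
  have hvs : ∀ x, Summable fun y => b x y * v y := fun x =>
    summable_of_sum_le (fun y => mul_nonneg (hb.1 x y) (hv0 y)) (hvsum x)
  refine ⟨v, fun x => ?_, hv0, fun h => ?_, fun x => ?_⟩
  · simpa only [abs_of_nonneg (hv0 _)] using hvs x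
  · simp [h] at hvo
  · rw [Hop_eq_diagCoeff_sub hb q hvs, sub_nonneg]
    exact (hvs x).tsum_le_of_sum_le (hvsum x)

/-- If `h` is critical then there is a nontrivial positive `H`-harmonic function and every
positive `H`-superharmonic function is `H`-harmonic. -/
theorem critical_implies_harmonic (b : X → X → ℝ) (q : X → ℝ) (hX : Infinite X)
    (hb : IsGraph b) (hconn : GraphConnected b)
    (hpos : ∀ φ : X → ℝ, FinSupp φ → 0 ≤ hform b q φ)
    (hcrit : ¬ Subcritical b q) :
    (∃ v : X → ℝ, MemF b v ∧ (∀ x, 0 ≤ v x) ∧ v ≠ 0 ∧ ∀ x, Hop b q v x = 0) ∧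
    ∀ u : X → ℝ, MemF b u → (∀ x, 0 ≤ u x) → u ≠ 0 → (∀ x, 0 ≤ Hop b q u x) →
      ∀ x, Hop b q u x = 0 := by
  have hharm : ∀ u : X → ℝ, MemF b u → (∀ x, 0 ≤ u x) → u ≠ 0 → (∀ x, 0 ≤ Hop b q u x) →
      ∀ x, Hop b q u x = 0 := by
    intro u huF hu0 hne hsup
    have hus : ∀ x, Summable fun y => b x y * u y := fun x => by
      simpa only [abs_of_nonneg (hu0 _)] using huF x
    have hup := pos_of_superharmonic hb hconn hu0 hus hne hsup
    by_contra! hx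
    obtain ⟨x, hx⟩ := hx
    exact hcrit ⟨fun x => Hop b q u x / u x, fun x => div_nonneg (hsup x) (hu0 x),
      fun h => div_ne_zero hx (hup x).ne' (congrFun h x),
      fun φ hφ => sum_Hop_div_mul_sq_le_hform hb hup hus hφ⟩
  obtain ⟨v, hvF, hv0, hvne, hv⟩ :=
    exists_superharmonic_of_not_subcritical hb hconn hpos hcrit
  exact ⟨⟨v, hvF, hv0, hvne, hharm v hvF hv0 hvne hv⟩, hharm⟩
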